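/- Let f be convex and L-smooth on a real inner product space, assume f attains a global minimum at x*, let δ ∈ (0,1), let h satisfy 3/(2(1+δ)) ≤ h ≤ (3δ+2-√(4-3δ²))/(2δ(δ+1)), let N ≥ 1, and define iterates x_{k+1} = x_k - (h/L)·d_k for k = 0, …, N-1, where each d_k satisfies ‖d_k - ∇f(x_k)‖ ≤ δ‖∇f(x_k)‖. Let λ̃ be the largest real root of the cubic [(δ²-1)h²+2h]λ³ + [2(δ²-1)h²+5h-4]λ² + [(δ²-1)h²+4h-4]λ + (h-1) = 0; assume λ̃ > 0 and h·λ̃² + 2(h-1)·λ̃ + h - 1 > 0. Then (1/L) · min over k ∈ {1,…,N} of ‖∇f(x_k)‖² ≤ (2λ̃ / (N·(h·λ̃² + 2(h-1)·λ̃ + h - 1) + λ̃)) · (f(x0) - f(x*)). -/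

import Mathlib

theorem aux_line {H : Type*} [NormedAddCommGroup H] [InnerProductSpace ℝ H] [CompleteSpace H]
    (f : H → ℝ) (f' : H → H) (hgrad : ∀ x, HasGradientAt f (f' x) x) (x v : H) (t : ℝ) :
    HasDerivAt (fun s : ℝ => f (x + s • v)) (inner ℝ (f' (x + t • v)) v) t := by
  have h1 : HasDerivAt (fun s : ℝ => x + s • v) v t := by
    simpa using ((hasDerivAt_id t).smul_const v).const_add x
  have h2 := (hgrad (x + t • v)).hasFDerivAt.comp_hasDerivAt t h1
  rw [InnerProductSpace.toDual_apply_apply] at h2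
  exact h2

theorem aux_descent {H : Type*} [NormedAddCommGroup H] [InnerProductSpace ℝ H] [CompleteSpace H]
    (f : H → ℝ) (f' : H → H) (L : ℝ) (hL : 0 < L)
    (hgrad : ∀ x, HasGradientAt f (f' x) x)
    (hlip : LipschitzWith L.toNNReal f') (x v : H) :
    f (x + v) ≤ f x + inner ℝ (f' x) v + L / 2 * ‖v‖ ^ 2 := by
  have hder : ∀ t : ℝ, HasDerivAt
      (fun s : ℝ => f (x + s • v) - (s * inner ℝ (f' x) v + s ^ 2 * (L / 2 * ‖v‖ ^ 2)))
      (inner ℝ (f' (x + t • v)) v - (1 * inner ℝ (f' x) v + (2 * t) * (L / 2 * ‖v‖ ^ 2))) t := by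
    intro t
    refine (aux_line f f' hgrad x v t).sub (HasDerivAt.add ?_ ?_)
    · exact (hasDerivAt_id t).mul_const _
    · have := (hasDerivAt_pow 2 t).mul_const (L / 2 * ‖v‖ ^ 2)
      simpa using this
  have hanti := antitoneOn_of_deriv_nonpos (convex_Icc (0 : ℝ) 1)
    (fun t _ => (hder t).continuousAt.continuousWithinAt)
    (fun t _ => (hder t).differentiableAt.differentiableWithinAt)
    (by
      intro t ht
      rw [interior_Icc] at ht
      rw [(hder t).deriv]
      have h1 : inner ℝ (f' (x + t • v) - f' x) v ≤ ‖f' (x + t • v) - f' x‖ * ‖v‖ :=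
        real_inner_le_norm _ _
      have h2 : ‖f' (x + t • v) - f' x‖ ≤ L * (t * ‖v‖) := by
        have := hlip.norm_sub_le (x + t • v) x
        rwa [Real.coe_toNNReal L hL.le, add_sub_cancel_left, norm_smul, Real.norm_eq_abs,
          abs_of_pos ht.1] at this
      have h3 := mul_le_mul_of_nonneg_right h2 (norm_nonneg v)
      rw [inner_sub_left] at h1
      nlinarith)
  have := hanti (Set.left_mem_Icc.2 zero_le_one) (Set.right_mem_Icc.2 zero_le_one) zero_le_one
  simp at this
  linarith

theorem aux_grad {H : Type*} [NormedAddCommGroup H] [InnerProductSpace ℝ H] [CompleteSpace H]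
    (f : H → ℝ) (f' : H → H) (hconv : ConvexOn ℝ Set.univ f)
    (hgrad : ∀ x, HasGradientAt f (f' x) x) (x v : H) :
    f x + inner ℝ (f' x) v ≤ f (x + v) := by
  have hc : ConvexOn ℝ Set.univ (fun s : ℝ => f (x + s • v)) := by
    refine ⟨convex_univ, fun a _ b _ p q hp hq hpq => ?_⟩
    have := hconv.2 (Set.mem_univ (x + a • v)) (Set.mem_univ (x + b • v)) hp hq hpq
    convert this using 2
    have : x = (p + q) • x := by rw [hpq, one_smul]
    conv_lhs => rw [this]
    simp only [smul_eq_mul]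
    module
  have := hc.le_slope_of_hasDerivAt (Set.mem_univ (0 : ℝ)) (Set.mem_univ (1 : ℝ)) one_pos
    (aux_line f f' hgrad x v 0)
  simp [slope_def_field] at this
  linarith

theorem aux_interp {H : Type*} [NormedAddCommGroup H] [InnerProductSpace ℝ H] [CompleteSpace H]
    (f : H → ℝ) (f' : H → H) (L : ℝ) (hL : 0 < L)
    (hconv : ConvexOn ℝ Set.univ f)
    (hgrad : ∀ x, HasGradientAt f (f' x) x)
    (hlip : LipschitzWith L.toNNReal f') (x y : H) :
    f x + inner ℝ (f' x) (y - x) + 1 / (2 * L) * ‖f' x - f' y‖ ^ 2 ≤ f y := by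
  have h1 := aux_grad f f' hconv hgrad x ((y - x) + (1 / L) • (f' x - f' y))
  have h2 := aux_descent f f' L hL hgrad hlip y ((1 / L) • (f' x - f' y))
  rw [show x + ((y - x) + (1 / L) • (f' x - f' y)) = y + (1 / L) • (f' x - f' y) by abel,
    inner_add_right, inner_smul_right] at h1
  rw [inner_smul_right, norm_smul, mul_pow, Real.norm_eq_abs, sq_abs] at h2
  have h3 : inner ℝ (f' x) (f' x - f' y) - inner ℝ (f' y) (f' x - f' y) = ‖f' x - f' y‖ ^ 2 := by
    rw [← inner_sub_left, real_inner_self_eq_norm_sq]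
  have h4 : L / 2 * ((1 / L) ^ 2 * ‖f' x - f' y‖ ^ 2) = 1 / (2 * L) * ‖f' x - f' y‖ ^ 2 := by
    field_simp
  have h5 : 1 / L * inner ℝ (f' x) (f' x - f' y) - 1 / L * inner ℝ (f' y) (f' x - f' y)
      = 2 * (1 / (2 * L) * ‖f' x - f' y‖ ^ 2) := by
    rw [← mul_sub, h3]; field_simp
  linarith

theorem aux_S (δ h a : ℝ) (hδ0 : 0 < δ) (ha : 0 < a) (hh0 : 0 < h) (hh : h ≤ 3 / 2)
    (hroot : ((δ ^ 2 - 1) * h ^ 2 + 2 * h) * a ^ 3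
        + (2 * (δ ^ 2 - 1) * h ^ 2 + 5 * h - 4) * a ^ 2
        + ((δ ^ 2 - 1) * h ^ 2 + 4 * h - 4) * a + (h - 1) = 0) :
    0 < 1 + 2 * a - (1 + a) * h := by
  by_contra hS
  push Not at hS
  have hprod : (1 + 2 * a - a * (1 + a) * h) * (1 + 2 * a - (1 + a) * h)
      = δ ^ 2 * h ^ 2 * a * (1 + a) ^ 2 := by linear_combination -hroot
  have hpos : 0 < δ ^ 2 * h ^ 2 * a * (1 + a) ^ 2 := by positivity
  have ha1 : a ≤ 1 := by nlinarith
  have hT : 0 ≤ 1 + 2 * a - a * (1 + a) * h := by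
    have : a * (1 + a) * h ≤ a * (1 + a) * (3 / 2) := by gcongr
    nlinarith
  nlinarith [mul_nonneg hT (neg_nonneg.2 hS)]

theorem aux_h (δ h : ℝ) (h0 : 0 < δ) (h1 : δ < 1)
    (hub : h ≤ (3 * δ + 2 - Real.sqrt (4 - 3 * δ ^ 2)) / (2 * δ * (δ + 1))) : h ≤ 3 / 2 := by
  refine hub.trans ?_
  rw [div_le_iff₀ (by positivity)]
  have : 2 - 3 * δ ^ 2 ≤ Real.sqrt (4 - 3 * δ ^ 2) := by
    apply Real.le_sqrt_of_sq_le
    have : δ ^ 2 ≤ 1 := by nlinarith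
    nlinarith [mul_nonneg (sq_nonneg δ) (sub_nonneg.2 this)]
  nlinarith

/-- the one-step inequality, for gradients `g`, `q` and direction `g + e` -/
theorem aux_quad {H : Type*} [NormedAddCommGroup H] [InnerProductSpace ℝ H]
    (g q e : H) (δ h a : ℝ) (hδ0 : 0 < δ) (ha : 0 < a) (hh0 : 0 < h)
    (hS : 0 < 1 + 2 * a - (1 + a) * h)
    (hroot : ((δ ^ 2 - 1) * h ^ 2 + 2 * h) * a ^ 3
        + (2 * (δ ^ 2 - 1) * h ^ 2 + 5 * h - 4) * a ^ 2
        + ((δ ^ 2 - 1) * h ^ 2 + 4 * h - 4) * a + (h - 1) = 0)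
    (he : ‖e‖ ≤ δ * ‖g‖) :
    (h * a ^ 2 + 2 * (h - 1) * a + h - 1) / (2 * a) * ‖q‖ ^ 2 ≤
      (1 + a) * h * inner ℝ q (g + e) - a * h * inner ℝ g (g + e)
        + (1 / 2 + a) * ‖g - q‖ ^ 2 := by
  set S := 1 + 2 * a - (1 + a) * h with hSdef
  have he2 : ‖e‖ ^ 2 ≤ δ ^ 2 * ‖g‖ ^ 2 := by
    rw [← mul_pow]; gcongr
  -- square : β e + (h/2)((1+a) q - a g), with β = h² a (1+a) / (2 S)
  have hsq : 0 ≤ ‖(h * a * (1 + a)) • e + S • ((1 + a) • q - a • g)‖ ^ 2 := sq_nonneg _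
  have hexp : ‖(h * a * (1 + a)) • e + S • ((1 + a) • q - a • g)‖ ^ 2
      = (h * a * (1 + a)) ^ 2 * ‖e‖ ^ 2
        + 2 * (h * a * (1 + a)) * S * ((1 + a) * inner ℝ q e - a * inner ℝ g e)
        + S ^ 2 * ((1 + a) ^ 2 * ‖q‖ ^ 2 - 2 * a * (1 + a) * inner ℝ g q + a ^ 2 * ‖g‖ ^ 2) := by
    rw [← real_inner_self_eq_norm_sq, ← real_inner_self_eq_norm_sq e,
      ← real_inner_self_eq_norm_sq g, ← real_inner_self_eq_norm_sq q]
    simp only [inner_add_left, inner_add_right, inner_sub_left, inner_sub_right,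
      real_inner_smul_left, real_inner_smul_right]
    rw [real_inner_comm e q, real_inner_comm e g, real_inner_comm q g]
    ring
  rw [hexp] at hsq
  rw [norm_sub_sq_real, inner_add_right, inner_add_right, real_inner_self_eq_norm_sq,
    real_inner_comm g q]
  have hm : (h * a * (1 + a)) ^ 2 * ‖e‖ ^ 2 ≤ (h * a * (1 + a)) ^ 2 * (δ ^ 2 * ‖g‖ ^ 2) := by
    gcongr
  generalize ‖e‖ ^ 2 = E at *
  generalize ‖g‖ ^ 2 = G at *
  generalize ‖q‖ ^ 2 = Q at *
  generalize (inner ℝ g q : ℝ) = gq at *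
  generalize (inner ℝ g e : ℝ) = ge at *
  generalize (inner ℝ q e : ℝ) = qe at *
  rw [← sub_nonneg]
  have hprod : (1 + 2 * a - a * (1 + a) * h) * S = δ ^ 2 * h ^ 2 * a * (1 + a) ^ 2 := by
    rw [hSdef]; linear_combination -hroot
  have hK : 0 < 2 * a * (1 + a) * S := by positivity
  refine nonneg_of_mul_nonneg_right (a := 2 * a * (1 + a) * S) ?_ hK
  have key : 2 * a * (1 + a) * S * ((1 + a) * h * (gq + qe) - a * h * (G + ge)
        + (1 / 2 + a) * (G - 2 * gq + Q)
        - (h * a ^ 2 + 2 * (h - 1) * a + h - 1) / (2 * a) * Q)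
      = (h * a * (1 + a)) ^ 2 * (δ ^ 2 * G)
        + 2 * (h * a * (1 + a)) * S * ((1 + a) * qe - a * ge)
        + S ^ 2 * ((1 + a) ^ 2 * Q - 2 * a * (1 + a) * gq + a ^ 2 * G) := by
    have : (h * a ^ 2 + 2 * (h - 1) * a + h - 1) / (2 * a) * (2 * a)
      = (h * a ^ 2 + 2 * (h - 1) * a + h - 1) := by field_simp
    rw [hSdef] at hprod ⊢
    linear_combination (a * G) * hprod - ((1 + a) * (1 + 2 * a - (1 + a) * h) * Q) * this
  rw [key]
  linarith

/-- `N` steps of relatively inexact gradient descent (inexactness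
`δ ∈ (0,1)`) on a convex `L`-smooth function with minimizer `xstar`, intermediate regime
`3/(2(1+δ)) ≤ h ≤ (3δ+2-√(4-3δ²))/(2δ(δ+1))`, where `lam` is the largest real root of the
cubic `[(δ²-1)h²+2h]λ³ + [2(δ²-1)h²+5h-4]λ² + [(δ²-1)h²+4h-4]λ + (h-1) = 0`:
`(1/L)·min_{k∈{1,…,N}} ‖∇f(x_k)‖² ≤ (2λ̃/(N(hλ̃²+2(h-1)λ̃+h-1)+λ̃)) · (f(x0) - f(x*))`. -/
theorem N_steps_inexact_gd_intermediate_regime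
    {H : Type*} [NormedAddCommGroup H] [InnerProductSpace ℝ H] [CompleteSpace H]
    (f : H → ℝ) (f' : H → H) (L : ℝ) (hL : 0 < L)
    (hconv : ConvexOn ℝ Set.univ f)
    (hgrad : ∀ x, HasGradientAt f (f' x) x)
    (hlip : LipschitzWith L.toNNReal f')
    (xstar : H) (hmin : ∀ y, f xstar ≤ f y)
    (δ : ℝ) (hδ : δ ∈ Set.Ioo (0 : ℝ) 1)
    (h : ℝ)
    (hlb : 3 / (2 * (1 + δ)) ≤ h)
    (hub : h ≤ (3 * δ + 2 - Real.sqrt (4 - 3 * δ ^ 2)) / (2 * δ * (δ + 1)))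
    (lam : ℝ)
    (hroot : ((δ ^ 2 - 1) * h ^ 2 + 2 * h) * lam ^ 3
        + (2 * (δ ^ 2 - 1) * h ^ 2 + 5 * h - 4) * lam ^ 2
        + ((δ ^ 2 - 1) * h ^ 2 + 4 * h - 4) * lam + (h - 1) = 0)
    (hlargest : ∀ μ : ℝ, ((δ ^ 2 - 1) * h ^ 2 + 2 * h) * μ ^ 3
        + (2 * (δ ^ 2 - 1) * h ^ 2 + 5 * h - 4) * μ ^ 2
        + ((δ ^ 2 - 1) * h ^ 2 + 4 * h - 4) * μ + (h - 1) = 0 → μ ≤ lam)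
    (hlam_pos : 0 < lam)
    (hden_pos : 0 < h * lam ^ 2 + 2 * (h - 1) * lam + h - 1)
    (N : ℕ) (hN : 1 ≤ N)
    (x : ℕ → H) (d : ℕ → H)
    (hd : ∀ k < N, ‖d k - f' (x k)‖ ≤ δ * ‖f' (x k)‖)
    (hstep : ∀ k < N, x (k + 1) = x k - (h / L) • d k) :
    (1 / L) * (Finset.Icc 1 N).inf' (Finset.nonempty_Icc.mpr hN)
        (fun k => ‖f' (x k)‖ ^ 2) ≤
      (2 * lam / ((N : ℝ) * (h * lam ^ 2 + 2 * (h - 1) * lam + h - 1) + lam)) *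
        (f (x 0) - f xstar) := by
  obtain ⟨hδ0, hδ1⟩ := hδ
  have hh0 : 0 < h := lt_of_lt_of_le (by positivity) hlb
  have hS := aux_S δ h lam hδ0 hlam_pos hh0 (aux_h δ h hδ0 hδ1 hub) hroot
  set D := h * lam ^ 2 + 2 * (h - 1) * lam + h - 1 with hD
  set m := (Finset.Icc 1 N).inf' (Finset.nonempty_Icc.mpr hN) (fun k => ‖f' (x k)‖ ^ 2) with hm
  have hmle : ∀ k, 1 ≤ k → k ≤ N → m ≤ ‖f' (x k)‖ ^ 2 := fun k h1 h2 =>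
    Finset.inf'_le (fun k => ‖f' (x k)‖ ^ 2) (Finset.mem_Icc.2 ⟨h1, h2⟩)
  have hone : ∀ k < N, D / (2 * lam) * m ≤ L * (f (x k) - f (x (k + 1))) := by
    intro k hk
    have hq := aux_quad (f' (x k)) (f' (x (k + 1))) (d k - f' (x k)) δ h lam hδ0 hlam_pos hh0 hS
      hroot (hd k hk)
    rw [add_sub_cancel] at hq
    have i1 := aux_interp f f' L hL hconv hgrad hlip (x (k + 1)) (x k)
    have i2 := aux_interp f f' L hL hconv hgrad hlip (x k) (x (k + 1))
    have e1 : x k - x (k + 1) = (h / L) • d k := by rw [hstep k hk]; abel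
    have e2 : x (k + 1) - x k = -((h / L) • d k) := by rw [hstep k hk]; abel
    rw [e1, inner_smul_right, norm_sub_rev] at i1
    rw [e2, inner_neg_right, inner_smul_right] at i2
    have j1 := mul_le_mul_of_nonneg_left i1 (by positivity : 0 ≤ L * (1 + lam))
    have j2 := mul_le_mul_of_nonneg_left i2 (by positivity : 0 ≤ L * lam)
    have hmk : D / (2 * lam) * m ≤ D / (2 * lam) * ‖f' (x (k + 1))‖ ^ 2 := by
      have := hmle (k + 1) (by omega) (by omega)
      gcongr
    have r1 : L * (h / L) = h := by field_simp
    have r2 : L * (1 / (2 * L)) = 1 / 2 := by field_simp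
    generalize (inner ℝ (f' (x (k + 1))) (d k) : ℝ) = u at *
    generalize (inner ℝ (f' (x k)) (d k) : ℝ) = w at *
    generalize ‖f' (x k) - f' (x (k + 1))‖ ^ 2 = z at *
    have s1 : L * (1 + lam) * (f (x (k + 1)) + h / L * u + 1 / (2 * L) * z)
        = (1 + lam) * (L * f (x (k + 1))) + (1 + lam) * h * u + (1 + lam) / 2 * z := by
      linear_combination (1 + lam) * u * r1 + (1 + lam) * z * r2
    have s2 : L * lam * (f (x k) + -(h / L * w) + 1 / (2 * L) * z)
        = lam * (L * f (x k)) - lam * h * w + lam / 2 * z := by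
      linear_combination (-lam * w) * r1 + lam * z * r2
    rw [s1] at j1
    rw [s2] at j2
    linarith
  have hsum : ∀ n ≤ N, (n : ℝ) * (D / (2 * lam) * m) ≤ L * (f (x 0) - f (x n)) := by
    intro n
    induction n with
    | zero => intro _; simp
    | succ n ih =>
      intro hn
      have a1 := ih (by omega)
      have a2 := hone n (by omega)
      push_cast
      linarith
  have hlast : 1 / 2 * m ≤ L * (f (x N) - f xstar) := by
    have a1 := aux_descent f f' L hL hgrad hlip (x N) (-((1 / L) • f' (x N)))
    have a2 := hmin (x N + -((1 / L) • f' (x N)))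
    rw [inner_neg_right, inner_smul_right, norm_neg, norm_smul, mul_pow, Real.norm_eq_abs, sq_abs,
      real_inner_self_eq_norm_sq] at a1
    have a3 := hmle N hN le_rfl
    have a4 := mul_le_mul_of_nonneg_left (a2.trans a1) hL.le
    have a5 : L * (f (x N) + -(1 / L * ‖f' (x N)‖ ^ 2) + L / 2 * ((1 / L) ^ 2 * ‖f' (x N)‖ ^ 2))
        = L * f (x N) - 1 / 2 * ‖f' (x N)‖ ^ 2 := by field_simp; ring
    rw [a5] at a4
    linarith
  have htot := hsum N le_rfl
  have hden : 0 < (N : ℝ) * D + lam := by positivity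
  have hfin : ((N : ℝ) * D + lam) * m ≤ 2 * lam * (L * (f (x 0) - f xstar)) := by
    have b1 := mul_le_mul_of_nonneg_left (add_le_add htot hlast) (by positivity : 0 ≤ 2 * lam)
    have b2 : D / (2 * lam) * (2 * lam) = D := by field_simp
    have b3 : 2 * lam * ((N : ℝ) * (D / (2 * lam) * m) + 1 / 2 * m) = ((N : ℝ) * D + lam) * m := by
      linear_combination (N : ℝ) * m * b2
    rw [b3] at b1
    linarith
  rw [div_mul_eq_mul_div, div_mul_eq_mul_div, one_mul, div_le_div_iff₀ hL hden]
  linarith
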